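/- Let p ⇒m q be a parallel multiplicative reduction of acyclic MLL proof nets, let χ be a path in q, and let c = ⟨⊗(t₁,…,tₙ)|⅋(s₁,…,sₙ)⟩ be a cut of p eliminated in this reduction. Then χ crosses at most two residual cut edges of c, and if it crosses two, χ can be written χ = χ₁(t ∼_{⟨t|s⟩} s)χ₂(s′ ∼_{⟨t′|s′⟩} t′)χ₃, i.e. χ first crosses one residual ⟨t|s⟩ from its ⊗-premise t to its ⅋-premise s and later crosses the other residual ⟨t′|s′⟩ from its ⅋-premise s′ to its ⊗-premise t′, where t,t′ ∈ {t₁,…,tₙ} and s,s′ ∈ {s₁,…,sₙ}. -/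

import Mathlib

/- Formalization of untyped MLL proof nets with jumps, switching paths,
   and parallel cut elimination, following Chouquet & Vaux Auclair. -/

namespace MLLNets

attribute [local instance] Classical.propDecidable

/-- Trees of MLL nets: variables (axiom conclusions, paired by the involution
    `(n,b) ↦ (n,!b)`), labelled units `1_λ`, labelled counits `⊥_μ`, and
    n-ary connectives `⊗`, `⅋`. -/
inductive Tree : Type where
  | var : ℕ → Bool → Tree
  | unit : ℕ → Tree
  | counit : ℕ → Tree
  | tens : List Tree → Tree
  | parr : List Tree → Tree

instance : Inhabited Tree := ⟨Tree.unit 0⟩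

/-- Atoms: variables, unit labels, counit labels. -/
inductive Atom : Type where
  | var : ℕ → Bool → Atom
  | unit : ℕ → Atom
  | counit : ℕ → Atom

namespace Tree

/-- Number of subtrees of a tree. -/
def size : Tree → ℕ
  | var _ _ => 1
  | unit _ => 1
  | counit _ => 1
  | tens ts => 1 + (ts.attach.map (fun x => x.1.size)).sum
  | parr ts => 1 + (ts.attach.map (fun x => x.1.size)).sum
termination_by t => sizeOf t
decreasing_by all_goals (have h := List.sizeOf_lt_of_mem x.2; simp; omega)

/-- The set of subtrees of a tree. -/
noncomputable def ST : Tree → Finset Tree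
  | var n b => {var n b}
  | unit l => {unit l}
  | counit l => {counit l}
  | tens ts => insert (tens ts) ((ts.attach.map (fun x => x.1.ST)).foldr (· ∪ ·) ∅)
  | parr ts => insert (parr ts) ((ts.attach.map (fun x => x.1.ST)).foldr (· ∪ ·) ∅)
termination_by t => sizeOf t
decreasing_by all_goals (have h := List.sizeOf_lt_of_mem x.2; simp; omega)

/-- The multiset of atoms occurring in a tree. -/
def atoms : Tree → Multiset Atom
  | var n b => {Atom.var n b}
  | unit l => {Atom.unit l}
  | counit l => {Atom.counit l}
  | tens ts => (ts.attach.map (fun x => x.1.atoms)).sum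
  | parr ts => (ts.attach.map (fun x => x.1.atoms)).sum
termination_by t => sizeOf t
decreasing_by all_goals (have h := List.sizeOf_lt_of_mem x.2; simp; omega)

/-- Substitution of the tree `s` for the variable `(n, b)`. -/
def subst (n : ℕ) (b : Bool) (s : Tree) : Tree → Tree
  | var m c => if m = n ∧ c = b then s else var m c
  | unit l => unit l
  | counit l => counit l
  | tens ts => tens (ts.attach.map (fun x => Tree.subst n b s x.1))
  | parr ts => parr (ts.attach.map (fun x => Tree.subst n b s x.1))
termination_by t => sizeOf t
decreasing_by all_goals (have h := List.sizeOf_lt_of_mem x.2; simp; omega)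

/-- Iterated substitution `t[t₁/x̄₁]⋯[tₙ/x̄ₙ]`: each list entry `((n,b), s)`
    records an axiom cut `⟨x|s⟩` with `x = (n,b)`, and `s` is substituted
    for `x̄ = (n, !b)`. -/
def substList (l : List ((ℕ × Bool) × Tree)) (t : Tree) : Tree :=
  l.foldl (fun u e => u.subst e.1.1 (!e.1.2) e.2) t

end Tree

/-- A (bare) proof net with a jump function: a finite set of cuts, a finite
    family of conclusion trees, and a jump function assigning a tree to each
    counit label. -/
structure Net : Type where
  cuts : Finset (Tree × Tree)
  concl : List Tree
  jump : ℕ → Tree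

namespace Net

/-- The subtrees of a net. -/
noncomputable def ST (p : Net) : Finset Tree :=
  (p.cuts.biUnion fun c => c.1.ST ∪ c.2.ST) ∪ (p.concl.map Tree.ST).foldr (· ∪ ·) ∅

/-- The multiset of atoms of a net. -/
def atoms (p : Net) : Multiset Atom :=
  (p.cuts.val.map fun c => c.1.atoms + c.2.atoms).sum + (p.concl.map Tree.atoms).sum

/-- The counit labels occurring in a net. -/
noncomputable def counitLabels (p : Net) : Finset ℕ :=
  p.ST.biUnion fun t => match t with | Tree.counit l => {l} | _ => ∅

/-- The size of a net: its number of subtrees. -/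
def size (p : Net) : ℕ :=
  (p.cuts.sum fun c => c.1.size + c.2.size) + (p.concl.map Tree.size).sum

/-- Well-formedness: each atom occurs at most once, connectives have arity
    ≥ 1, variables are closed under the involution, and jumps of counits
    occurring in the net are subtrees of the net. -/
def IsMLL (p : Net) : Prop :=
  p.atoms.Nodup ∧
  (∀ ts, Tree.tens ts ∈ p.ST → ts ≠ []) ∧
  (∀ ts, Tree.parr ts ∈ p.ST → ts ≠ []) ∧
  (∀ n b, Atom.var n b ∈ p.atoms → Atom.var n (!b) ∈ p.atoms) ∧
  (∀ m, Tree.counit m ∈ p.ST → p.jump m ∈ p.ST)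

end Net

/-- Edges of switching graphs: axiom edges, ⊗-edges (one per premise),
    ⅋-edges (one per ⅋-tree, its other endpoint chosen by the switching),
    jump edges and cut edges. -/
inductive Edge : Type where
  | ax : ℕ → Edge
  | tensE : Tree → Tree → Edge
  | parrE : Tree → Edge
  | jumpE : ℕ → Edge
  | cutE : Tree → Tree → Edge

/-- A switching chooses a premise of each ⅋-subtree. -/
def Net.IsSwitching (p : Net) (I : Tree → Tree) : Prop :=
  ∀ ts, Tree.parr ts ∈ p.ST → I (Tree.parr ts) ∈ ts

/-- Adjacency in the switching graph of `p` determined by the switching `I`. -/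
inductive Net.Adj (p : Net) (I : Tree → Tree) : Edge → Tree → Tree → Prop
  | ax (n : ℕ) : Tree.var n true ∈ p.ST → Tree.var n false ∈ p.ST →
      Net.Adj p I (Edge.ax n) (Tree.var n true) (Tree.var n false)
  | tens {ts t} : Tree.tens ts ∈ p.ST → t ∈ ts →
      Net.Adj p I (Edge.tensE (Tree.tens ts) t) (Tree.tens ts) t
  | parr {ts} : Tree.parr ts ∈ p.ST →
      Net.Adj p I (Edge.parrE (Tree.parr ts)) (Tree.parr ts) (I (Tree.parr ts))
  | jump {m} : Tree.counit m ∈ p.ST →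
      Net.Adj p I (Edge.jumpE m) (Tree.counit m) (p.jump m)
  | cut {t s} : (t, s) ∈ p.cuts → Net.Adj p I (Edge.cutE t s) t s
  | symm {e t u} : Net.Adj p I e t u → Net.Adj p I e u t

/-- `IsTrail p I t l` : `l` is a switching path (a sequence of pairwise
    distinct consecutive edges, each paired with the vertex it reaches)
    starting from the subtree `t`. -/
inductive Net.IsTrail (p : Net) (I : Tree → Tree) : Tree → List (Edge × Tree) → Prop
  | nil (t) : t ∈ p.ST → Net.IsTrail p I t []
  | cons {t e u l} : Net.Adj p I e t u → Net.IsTrail p I u l → (∀ x ∈ l, x.1 ≠ e) →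
      Net.IsTrail p I t ((e, u) :: l)

/-- `ln p` : the maximal length of a switching path of `p`. -/
noncomputable def Net.ln (p : Net) : ℕ :=
  sSup {n | ∃ I t l, p.IsSwitching I ∧ p.IsTrail I t l ∧ l.length = n}

/-- `jd p` : the maximal number of counit labels jumping to a common
    subtree of `p`. -/
noncomputable def Net.jd (p : Net) : ℕ :=
  p.ST.sup fun t => (p.counitLabels.filter fun m => p.jump m = t).card

/-- A net is acyclic when no switching path visits the same subtree twice. -/
def Net.IsAcyclic (p : Net) : Prop :=
  ∀ I, p.IsSwitching I → ∀ t l, p.IsTrail I t l → (t :: l.map Prod.snd).Nodup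

/-! ### Parallel cut elimination -/

/-- Cuts of `p` eliminated by the multiplicative family `F` (given by the
    lists of premises of the ⊗- and ⅋-trees of each cut). -/
noncomputable def melim (F : Finset (List Tree × List Tree)) : Finset (Tree × Tree) :=
  F.biUnion fun c => {(Tree.tens c.1, Tree.parr c.2), (Tree.parr c.2, Tree.tens c.1)}

/-- Residual cuts produced by the multiplicative family `F`. -/
noncomputable def mres (F : Finset (List Tree × List Tree)) : Finset (Tree × Tree) :=
  F.biUnion fun c => (c.1.zip c.2).toFinset

/-- Cuts of `p` eliminated by an axiom family. -/
noncomputable def aelim (la : List ((ℕ × Bool) × Tree)) : Finset (Tree × Tree) :=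
  la.foldr (fun e s =>
    insert (Tree.var e.1.1 e.1.2, e.2) (insert (e.2, Tree.var e.1.1 e.1.2) s)) ∅

/-- Cuts of `p` eliminated by an evanescent family (pairs `(λ, μ)` of a unit
    and a counit label). -/
noncomputable def eelim (le : List (ℕ × ℕ)) : Finset (Tree × Tree) :=
  le.foldr (fun e s =>
    insert (Tree.unit e.1, Tree.counit e.2) (insert (Tree.counit e.2, Tree.unit e.1) s)) ∅

/-- The redirection function `ρ` for the parallel elimination of evanescent
    cuts: `Rho p le j t` holds when the jump of the `j`-th eliminated
    counit, followed along the chain of eliminated evanescent cuts, ends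
    at the tree `t`. -/
inductive Rho (p : Net) (le : List (ℕ × ℕ)) : ℕ → Tree → Prop
  | base (j : ℕ) :
      (∀ i < j, p.jump ((le.getD j (0,0)).2) ≠ Tree.counit ((le.getD i (0,0)).2) ∧
                p.jump ((le.getD j (0,0)).2) ≠ Tree.unit ((le.getD i (0,0)).1)) →
      Rho p le j (p.jump ((le.getD j (0,0)).2))
  | step {i j : ℕ} {t : Tree} : i < j →
      (p.jump ((le.getD j (0,0)).2) = Tree.counit ((le.getD i (0,0)).2) ∨
       p.jump ((le.getD j (0,0)).2) = Tree.unit ((le.getD i (0,0)).1)) →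
      Rho p le i t → Rho p le j t

/-- `ParStepF p q F la le` : `q` is obtained from `p` by the simultaneous
    elimination of the family `F` of multiplicative cuts, the family `la` of
    axiom cuts and the family `le` of evanescent cuts. -/
structure ParStepF (p q : Net) (F : Finset (List Tree × List Tree))
    (la : List ((ℕ × Bool) × Tree)) (le : List (ℕ × ℕ)) : Prop where
  /-- each member of `F` is a multiplicative cut of `p` -/
  hF : ∀ c ∈ F, c.1.length = c.2.length ∧ c.1 ≠ [] ∧
       ((Tree.tens c.1, Tree.parr c.2) ∈ p.cuts ∨ (Tree.parr c.2, Tree.tens c.1) ∈ p.cuts)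
  /-- each member of `la` is an axiom cut of `p` -/
  ha : ∀ e ∈ la, (Tree.var e.1.1 e.1.2, e.2) ∈ p.cuts ∨ (e.2, Tree.var e.1.1 e.1.2) ∈ p.cuts
  haN : (la.map Prod.fst).Nodup
  /-- `x̄ᵢ ∉ {x₁, …, xₙ}` -/
  haBar : ∀ e ∈ la, (e.1.1, !e.1.2) ∉ la.map Prod.fst
  /-- `x̄ᵢ` does not occur in `tⱼ` for `i ≤ j` -/
  haFv : ∀ i j, i ≤ j → j < la.length →
      Atom.var (la.getD i default).1.1 (!(la.getD i default).1.2) ∉ (la.getD j default).2.atoms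
  /-- each member of `le` is a cut of `p` between a unit and a counit -/
  he : ∀ e ∈ le, (Tree.unit e.1, Tree.counit e.2) ∈ p.cuts ∨ (Tree.counit e.2, Tree.unit e.1) ∈ p.cuts
  heN : (le.map Prod.snd).Nodup
  /-- `jump(μᵢ) ∉ {⊥_{μⱼ}, 1_{λⱼ}}` for `i ≤ j` (in particular each eliminated
      evanescent cut is reducible) -/
  heJ : ∀ i j, i ≤ j → j < le.length →
      p.jump ((le.getD i (0,0)).2) ≠ Tree.counit ((le.getD j (0,0)).2) ∧
      p.jump ((le.getD i (0,0)).2) ≠ Tree.unit ((le.getD j (0,0)).1)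
  /-- the cuts of `q`: the remaining cuts plus the multiplicative residuals,
      under the substitution generated by the axiom cuts -/
  hcuts : q.cuts = ((p.cuts \ (melim F ∪ aelim la ∪ eelim le)) ∪ mres F).image
      (fun c => (Tree.substList la c.1, Tree.substList la c.2))
  /-- the conclusions of `q` -/
  hconcl : q.concl = p.concl.map (Tree.substList la)
  /-- the jump function of `q`, with redirections -/
  hjump : ∀ m, Tree.counit m ∈ q.ST →
      (∃ c ∈ F, p.jump m = Tree.tens c.1 ∧ q.jump m = Tree.substList la c.1.headI) ∨
      (∃ c ∈ F, p.jump m = Tree.parr c.2 ∧ q.jump m = Tree.substList la c.2.headI) ∨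
      (∃ i < la.length,
        (p.jump m = Tree.var (la.getD i default).1.1 (la.getD i default).1.2 ∨
         p.jump m = Tree.var (la.getD i default).1.1 (!(la.getD i default).1.2)) ∧
        q.jump m = Tree.substList (la.drop (i+1)) (la.getD i default).2) ∨
      (∃ i < le.length,
        (p.jump m = Tree.counit ((le.getD i (0,0)).2) ∨
         p.jump m = Tree.unit ((le.getD i (0,0)).1)) ∧
        ∃ t, Rho p le i t ∧ q.jump m = Tree.substList la t) ∨
      ((∀ c ∈ F, p.jump m ≠ Tree.tens c.1 ∧ p.jump m ≠ Tree.parr c.2) ∧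
       (∀ e ∈ la, p.jump m ≠ Tree.var e.1.1 e.1.2 ∧ p.jump m ≠ Tree.var e.1.1 (!e.1.2)) ∧
       (∀ e ∈ le, p.jump m ≠ Tree.counit e.2 ∧ p.jump m ≠ Tree.unit e.1) ∧
       q.jump m = Tree.substList la (p.jump m))

/-- Parallel elimination of a family of multiplicative cuts (`p ⇒m q`). -/
def MultStep (p q : Net) : Prop := ∃ F, ParStepF p q F [] []

/-- Parallel elimination of a family of axiom cuts (`p ⇒a q`). -/
def AxStep (p q : Net) : Prop := ∃ la, ParStepF p q ∅ la []

/-- Parallel elimination of a family of evanescent cuts (`p ⇒e q`). -/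
def EvStep (p q : Net) : Prop := ∃ le, ParStepF p q ∅ [] le

/-- A parallel cut elimination step (`p ⇒ q`), eliminating an arbitrary
    family of reducible cuts of the three kinds. -/
def ParStep (p q : Net) : Prop := ∃ F la le, ParStepF p q F la le

/-- Elimination of a single reducible cut. -/
def Step1 (p q : Net) : Prop :=
  (∃ c, ParStepF p q {c} [] []) ∨ (∃ e, ParStepF p q ∅ [e] []) ∨ (∃ e, ParStepF p q ∅ [] [e])

/-- `k` parallel cut elimination steps. -/
def ParStepN : ℕ → Net → Net → Prop
  | 0, p, q => p = q
  | k+1, p, q => ∃ r, ParStep p r ∧ ParStepN k r q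

/-! ### Evanescent cuts and the sets `Iⁿ(t)` -/

/-- `p.IsEvCut l m` : `⟨1_l | ⊥_m⟩` is a reducible evanescent cut of `p`. -/
def Net.IsEvCut (p : Net) (l m : ℕ) : Prop :=
  ((Tree.unit l, Tree.counit m) ∈ p.cuts ∨ (Tree.counit m, Tree.unit l) ∈ p.cuts) ∧
  p.jump m ≠ Tree.unit l ∧ p.jump m ≠ Tree.counit m

/-- The sets `Iⁿ(t)` of counit labels reaching `t` through a chain of `n`
    evanescent cuts. -/
noncomputable def Net.Iset (p : Net) (t : Tree) : ℕ → Finset ℕ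
  | 0 => p.counitLabels.filter fun m => p.jump m = t
  | n+1 => p.counitLabels.filter fun m' =>
      ∃ l m, p.IsEvCut l m ∧ m ∈ p.Iset t n ∧
        (p.jump m' = Tree.counit m ∨ p.jump m' = Tree.unit l)

/-- The number of evanescent cuts of `p`. -/
noncomputable def Net.evCutCount (p : Net) : ℕ :=
  (p.cuts.filter fun c => ∃ l m,
    (c = (Tree.unit l, Tree.counit m) ∨ c = (Tree.counit m, Tree.unit l)) ∧
    p.jump m ≠ Tree.unit l ∧ p.jump m ≠ Tree.counit m).card

/-! ### The function φ -/

/-- `φ(0) = 0` and `φ(n) = n + (n+1)(φ(n-1)+2)` for `n > 0`. -/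
def phi : ℕ → ℕ
  | 0 => 0
  | n + 1 => (n + 1) + (n + 2) * (phi n + 2)

/-! ### Residual edges, slipknots, bridges and bounces -/

/-- The residual cut edges in `q` of an eliminated multiplicative cut. -/
noncomputable def resEdges (c : List Tree × List Tree) : Finset Edge :=
  ((c.1.zip c.2).map fun d => Edge.cutE d.1 d.2).toFinset

/-- Canonical form of a `c`-bridge: a path bound to `c` crossing its cut edge. -/
def IsBridgeCan (c : List Tree × List Tree) (b : List Edge) : Prop :=
  ∃ pre post : List Edge,
    (pre = [] ∨ ∃ t ∈ c.1, pre = [Edge.tensE (Tree.tens c.1) t]) ∧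
    (post = [] ∨ post = [Edge.parrE (Tree.parr c.2)]) ∧
    (b = pre ++ Edge.cutE (Tree.tens c.1) (Tree.parr c.2) :: post ∨
     b = pre ++ Edge.cutE (Tree.parr c.2) (Tree.tens c.1) :: post)

/-- A `c`-bridge, in either direction. -/
def IsBridge (c : List Tree × List Tree) (b : List Edge) : Prop :=
  IsBridgeCan c b ∨ IsBridgeCan c b.reverse

/-- A `c`-bounce: a path bound to `c`, not crossing its cut edge, and
    visiting its ⊗-tree. -/
def IsBounce (c : List Tree × List Tree) (b : List Edge) : Prop :=
  b = [] ∨ (∃ t ∈ c.1, b = [Edge.tensE (Tree.tens c.1) t]) ∨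
  (∃ t ∈ c.1, ∃ t' ∈ c.1, t ≠ t' ∧
    b = [Edge.tensE (Tree.tens c.1) t, Edge.tensE (Tree.tens c.1) t'])

/-- `Gen F es es'` : the edge sequence `es'` (in `p`) is generated by the
    straight edge sequence `es` (in `q`): preserved edges are kept, and each
    residual cut edge is replaced by a bridge of the corresponding
    eliminated cut. -/
inductive Gen (F : Finset (List Tree × List Tree)) : List Edge → List Edge → Prop
  | nil : Gen F [] []
  | pres {e l l'} : (∀ c ∈ F, e ∉ resEdges c) → Gen F l l' → Gen F (e :: l) (e :: l')
  | res {c d l l' b} : c ∈ F → d ∈ resEdges c → IsBridge c b → Gen F l l' →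
      Gen F (d :: l) (b ++ l')

/-- A straight path: a path with no slipknot, i.e. crossing at most one
    residual of each eliminated cut. -/
def Straight (F : Finset (List Tree × List Tree)) (l : List (Edge × Tree)) : Prop :=
  ¬ ∃ c ∈ F, ∃ l₁ l₂ l₃ : List (Edge × Tree), ∃ d v d' v',
      d ∈ resEdges c ∧ d' ∈ resEdges c ∧ l = l₁ ++ (d, v) :: l₂ ++ (d', v') :: l₃

/-- Independent paths: disjoint, and crossing residuals of no common
    eliminated cut. -/
def Indep (F : Finset (List Tree × List Tree)) (l₁ l₂ : List (Edge × Tree)) : Prop :=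
  (∀ x ∈ l₁, ∀ y ∈ l₂, x.1 ≠ y.1) ∧
  ¬ ∃ c ∈ F, (∃ x ∈ l₁, x.1 ∈ resEdges c) ∧ (∃ y ∈ l₂, y.1 ∈ resEdges c)

/-- `DecompWith F l cs χs ξs` : the decomposition `l = χ₁ξ₁⋯χₙξₙχₙ₊₁` of a
    path of `q` into pairwise independent straight paths `χᵢ` and slipknots
    `ξᵢ` on the pairwise distinct eliminated cuts `cs = c₁, …, cₙ`. -/
def DecompWith (F : Finset (List Tree × List Tree)) (l : List (Edge × Tree))
    (cs : List (List Tree × List Tree)) (χs ξs : List (List (Edge × Tree))) : Prop :=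
  cs.Nodup ∧ (∀ c ∈ cs, c ∈ F) ∧
  χs.length = cs.length + 1 ∧ ξs.length = cs.length ∧
  l = (List.zipWith (· ++ ·) χs (ξs ++ [[]])).flatten ∧
  (∀ x ∈ χs, Straight F x ∧ ∀ c ∈ cs, ∀ y ∈ x, y.1 ∉ resEdges c) ∧
  χs.Pairwise (Indep F) ∧
  List.Forall₂ (fun (ξ : List (Edge × Tree)) (c : List Tree × List Tree) =>
      ∃ t s t' s' mid, (t, s) ∈ c.1.zip c.2 ∧ (t', s') ∈ c.1.zip c.2 ∧ t ≠ t' ∧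
        ξ = (Edge.cutE t s, s) :: mid ++ [(Edge.cutE t' s', t')]) ξs cs

/-- `Decomp F l cs` : some decomposition of `l` along the cut sequence `cs`
    exists. -/
def Decomp (F : Finset (List Tree × List Tree)) (l : List (Edge × Tree))
    (cs : List (List Tree × List Tree)) : Prop :=
  ∃ χs ξs, DecompWith F l cs χs ξs

/-! ### α-equivalence -/

/-- A renaming of atoms: a map on variable names together with a possible
    flip of polarities (so as to commute with the involution), a map on unit
    labels and a map on counit labels. -/
structure Ren : Type where
  v : ℕ → ℕ
  vb : ℕ → Bool
  u : ℕ → ℕ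
  c : ℕ → ℕ

/-- Applying a renaming to a tree. -/
def Tree.rename (r : Ren) : Tree → Tree
  | Tree.var n b => Tree.var (r.v n) (xor b (r.vb n))
  | Tree.unit l => Tree.unit (r.u l)
  | Tree.counit l => Tree.counit (r.c l)
  | Tree.tens ts => Tree.tens (ts.attach.map (fun x => Tree.rename r x.1))
  | Tree.parr ts => Tree.parr (ts.attach.map (fun x => Tree.rename r x.1))
termination_by t => sizeOf t
decreasing_by all_goals (have h := List.sizeOf_lt_of_mem x.2; simp; omega)

/-- α-equivalence of nets: renaming of atoms (preserving the involution on
    variables) and reindexing of cuts. -/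
def AlphaEq (p q : Net) : Prop :=
  ∃ r : Ren, Function.Bijective r.v ∧ Function.Bijective r.u ∧ Function.Bijective r.c ∧
    q.cuts = p.cuts.image (fun c => (c.1.rename r, c.2.rename r)) ∧
    q.concl = p.concl.map (Tree.rename r) ∧
    (∀ m, Tree.counit m ∈ p.ST → q.jump (r.c m) = (p.jump m).rename r)

end MLLNets

namespace MLLNets

attribute [local instance] Classical.propDecidable

open Relation

/-! ### Subtrees and atoms -/

theorem mem_foldr_union {α : Type*} (l : List (Finset α)) (x : α) :
    x ∈ l.foldr (· ∪ ·) ∅ ↔ ∃ s ∈ l, x ∈ s := by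
  induction l with
  | nil => simp
  | cons a l ih => simp [ih]

namespace Tree

theorem mem_ST_tens {ts : List Tree} {u : Tree} :
    u ∈ (tens ts).ST ↔ u = tens ts ∨ ∃ t ∈ ts, u ∈ t.ST := by
  rw [ST, Finset.mem_insert, mem_foldr_union]
  simp

theorem mem_ST_parr {ts : List Tree} {u : Tree} :
    u ∈ (parr ts).ST ↔ u = parr ts ∨ ∃ t ∈ ts, u ∈ t.ST := by
  rw [ST, Finset.mem_insert, mem_foldr_union]
  simp

theorem self_mem_ST (t : Tree) : t ∈ t.ST := by
  cases t with
  | var n b => simp [ST]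
  | unit l => simp [ST]
  | counit l => simp [ST]
  | tens ts => exact mem_ST_tens.2 (Or.inl rfl)
  | parr ts => exact mem_ST_parr.2 (Or.inl rfl)

/-- Structural induction on trees, with an induction hypothesis for each premise. -/
theorem premise_induction {P : Tree → Prop} (var : ∀ n b, P (var n b)) (unit : ∀ l, P (unit l))
    (counit : ∀ l, P (counit l)) (tens : ∀ ts, (∀ t ∈ ts, P t) → P (tens ts))
    (parr : ∀ ts, (∀ t ∈ ts, P t) → P (parr ts)) : ∀ t, P t
  | .var n b => var n b
  | .unit l => unit l
  | .counit l => counit l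
  | .tens ts => tens ts fun t _ => premise_induction var unit counit tens parr t
  | .parr ts => parr ts fun t _ => premise_induction var unit counit tens parr t
termination_by t => sizeOf t
decreasing_by all_goals (have h := List.sizeOf_lt_of_mem ‹_›; simp; omega)

theorem ST_subset {u t : Tree} (h : u ∈ t.ST) : u.ST ⊆ t.ST := by
  induction t using premise_induction with
  | var n b => simp only [ST, Finset.mem_singleton] at h; rw [h]
  | unit l => simp only [ST, Finset.mem_singleton] at h; rw [h]
  | counit l => simp only [ST, Finset.mem_singleton] at h; rw [h]
  | tens ts ih =>
    rcases mem_ST_tens.1 h with rfl | ⟨t, ht, hu⟩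
    · rfl
    · exact fun x hx => mem_ST_tens.2 (Or.inr ⟨t, ht, ih t ht hu hx⟩)
  | parr ts ih =>
    rcases mem_ST_parr.1 h with rfl | ⟨t, ht, hu⟩
    · rfl
    · exact fun x hx => mem_ST_parr.2 (Or.inr ⟨t, ht, ih t ht hu hx⟩)

theorem sizeOf_le_of_mem_ST {u t : Tree} (h : u ∈ t.ST) : sizeOf u ≤ sizeOf t := by
  induction t using premise_induction with
  | var n b => simp only [ST, Finset.mem_singleton] at h; rw [h]
  | unit l => simp only [ST, Finset.mem_singleton] at h; rw [h]
  | counit l => simp only [ST, Finset.mem_singleton] at h; rw [h]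
  | tens ts ih =>
    rcases mem_ST_tens.1 h with rfl | ⟨t, ht, hu⟩
    · rfl
    · have h₁ := ih t ht hu
      have h₂ := List.sizeOf_lt_of_mem ht
      simp only [tens.sizeOf_spec]
      omega
  | parr ts ih =>
    rcases mem_ST_parr.1 h with rfl | ⟨t, ht, hu⟩
    · rfl
    · have h₁ := ih t ht hu
      have h₂ := List.sizeOf_lt_of_mem ht
      simp only [parr.sizeOf_spec]
      omega

theorem atoms_tens (ts : List Tree) : (tens ts).atoms = (ts.map atoms).sum := by
  rw [atoms, List.attach_map_val (f := atoms)]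

theorem atoms_parr (ts : List Tree) : (parr ts).atoms = (ts.map atoms).sum := by
  rw [atoms, List.attach_map_val (f := atoms)]

theorem atoms_le_of_mem_ST {u t : Tree} (h : u ∈ t.ST) : u.atoms ≤ t.atoms := by
  induction t using premise_induction with
  | var n b => simp only [ST, Finset.mem_singleton] at h; rw [h]
  | unit l => simp only [ST, Finset.mem_singleton] at h; rw [h]
  | counit l => simp only [ST, Finset.mem_singleton] at h; rw [h]
  | tens ts ih =>
    rcases mem_ST_tens.1 h with rfl | ⟨t, ht, hu⟩
    · rfl
    · rw [atoms_tens]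
      exact (ih t ht hu).trans (List.single_le_sum (by simp) _ (List.mem_map_of_mem ht))
  | parr ts ih =>
    rcases mem_ST_parr.1 h with rfl | ⟨t, ht, hu⟩
    · rfl
    · rw [atoms_parr]
      exact (ih t ht hu).trans (List.single_le_sum (by simp) _ (List.mem_map_of_mem ht))

end Tree

theorem pairwise_disjoint_of_nodup_sum {α β : Type*} (f : α → Multiset β) {l : List α}
    (h : (l.map f).sum.Nodup) : l.Pairwise fun a b => Disjoint (f a) (f b) := by
  induction l with
  | nil => exact List.Pairwise.nil
  | cons a l ih =>
    rw [List.map_cons, List.sum_cons, Multiset.nodup_add] at h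
    refine List.Pairwise.cons (fun b hb => ?_) (ih h.2.1)
    exact h.2.2.mono_right (List.single_le_sum (by simp) _ (List.mem_map_of_mem hb))

theorem disjoint_of_nodup_sum {α β : Type*} (f : α → Multiset β) {l : List α}
    (h : (l.map f).sum.Nodup) {a b : α} (ha : a ∈ l) (hb : b ∈ l) (hab : a ≠ b) :
    Disjoint (f a) (f b) := by
  have : Std.Symm fun a b => Disjoint (f a) (f b) := ⟨fun _ _ h => h.symm⟩
  exact (pairwise_disjoint_of_nodup_sum f h).forall ha hb hab

theorem nodup_of_nodup_sum {α β : Type*} (f : α → Multiset β) {l : List α}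
    (h : (l.map f).sum.Nodup) (h₀ : ∀ a ∈ l, f a ≠ 0) : l.Nodup := by
  refine (pairwise_disjoint_of_nodup_sum f h).imp_of_mem fun {a b} ha _ hd hab => ?_
  subst hab
  exact h₀ a ha (by simpa using hd)

theorem eq_of_mem_zip_of_nodup {α β : Type*} {l : List α} {m : List β} (h : l.Nodup) {a : α}
    {b b' : β} (hb : (a, b) ∈ l.zip m) (hb' : (a, b') ∈ l.zip m) : b = b' := by
  induction l generalizing m with
  | nil => simp at hb
  | cons x l ih =>
    cases m with
    | nil => simp at hb
    | cons y m =>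
      rw [List.nodup_cons] at h
      simp only [List.zip_cons_cons, List.mem_cons, Prod.mk.injEq] at hb hb'
      rcases hb with ⟨rfl, rfl⟩ | hb <;> rcases hb' with ⟨h₁, h₂⟩ | hb'
      · exact h₂.symm
      · exact absurd (List.of_mem_zip hb').1 h.1
      · subst h₁; exact absurd (List.of_mem_zip hb).1 h.1
      · exact ih h.2 hb hb'

namespace Net

/-- The trees of a net which are not premises of another tree. -/
noncomputable def roots (p : Net) : List Tree :=
  p.cuts.toList.flatMap (fun c => [c.1, c.2]) ++ p.concl

theorem mem_roots {p : Net} {r : Tree} :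
    r ∈ p.roots ↔ (∃ c ∈ p.cuts, r = c.1 ∨ r = c.2) ∨ r ∈ p.concl := by
  simp [roots]

theorem mem_ST {p : Net} {t : Tree} : t ∈ p.ST ↔ ∃ r ∈ p.roots, t ∈ r.ST := by
  simp only [ST, Finset.mem_union, Finset.mem_biUnion, mem_foldr_union, List.mem_map, mem_roots]
  aesop

theorem atoms_eq_sum_cuts (p : Net) : p.atoms =
    (p.cuts.toList.map fun c => c.1.atoms + c.2.atoms).sum + (p.concl.map Tree.atoms).sum := by
  rw [atoms, ← Finset.coe_toList p.cuts, Multiset.map_coe, Multiset.sum_coe]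

theorem atoms_eq_sum_roots (p : Net) : p.atoms = (p.roots.map Tree.atoms).sum := by
  rw [atoms_eq_sum_cuts, roots, List.map_append, List.sum_append]
  congr 1
  induction p.cuts.toList with
  | nil => rfl
  | cons a l ih => simp [ih, add_assoc]

theorem ST_subset {p : Net} {t : Tree} (h : t ∈ p.ST) : t.ST ⊆ p.ST := by
  obtain ⟨r, hr, ht⟩ := mem_ST.1 h
  exact fun x hx => mem_ST.2 ⟨r, hr, Tree.ST_subset ht hx⟩

theorem premise_mem_ST_of_tens {p : Net} {ts : List Tree} (h : Tree.tens ts ∈ p.ST) {t : Tree}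
    (ht : t ∈ ts) : t ∈ p.ST :=
  ST_subset h (Tree.mem_ST_tens.2 (Or.inr ⟨t, ht, t.self_mem_ST⟩))

theorem premise_mem_ST_of_parr {p : Net} {ts : List Tree} (h : Tree.parr ts ∈ p.ST) {t : Tree}
    (ht : t ∈ ts) : t ∈ p.ST :=
  ST_subset h (Tree.mem_ST_parr.2 (Or.inr ⟨t, ht, t.self_mem_ST⟩))

theorem fst_mem_ST {p : Net} {c : Tree × Tree} (h : c ∈ p.cuts) : c.1 ∈ p.ST :=
  mem_ST.2 ⟨c.1, mem_roots.2 (Or.inl ⟨c, h, Or.inl rfl⟩), c.1.self_mem_ST⟩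

theorem snd_mem_ST {p : Net} {c : Tree × Tree} (h : c ∈ p.cuts) : c.2 ∈ p.ST :=
  mem_ST.2 ⟨c.2, mem_roots.2 (Or.inl ⟨c, h, Or.inr rfl⟩), c.2.self_mem_ST⟩

theorem IsMLL.atoms_ne_zero {p : Net} (hp : p.IsMLL) {t : Tree} (h : t ∈ p.ST) :
    t.atoms ≠ 0 := by
  induction t using Tree.premise_induction with
  | var n b => simp [Tree.atoms]
  | unit l => simp [Tree.atoms]
  | counit l => simp [Tree.atoms]
  | tens ts ih =>
    obtain ⟨t, ht⟩ := List.exists_mem_of_ne_nil ts (hp.2.1 ts h)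
    have hle := Tree.atoms_le_of_mem_ST (Tree.mem_ST_tens.2 (Or.inr ⟨t, ht, t.self_mem_ST⟩))
    exact fun h₀ => ih t ht (premise_mem_ST_of_tens h ht) (Multiset.le_zero.1 (h₀ ▸ hle))
  | parr ts ih =>
    obtain ⟨t, ht⟩ := List.exists_mem_of_ne_nil ts (hp.2.2.1 ts h)
    have hle := Tree.atoms_le_of_mem_ST (Tree.mem_ST_parr.2 (Or.inr ⟨t, ht, t.self_mem_ST⟩))
    exact fun h₀ => ih t ht (premise_mem_ST_of_parr h ht) (Multiset.le_zero.1 (h₀ ▸ hle))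

theorem IsMLL.eq_of_root_mem_ST {p : Net} (hp : p.IsMLL) {u r : Tree} (hu : u ∈ p.roots)
    (hr : r ∈ p.roots) (h : u ∈ r.ST) : u = r := by
  by_contra hne
  have hn := hp.1
  rw [atoms_eq_sum_roots] at hn
  have hd := disjoint_of_nodup_sum _ hn hu hr hne
  refine hp.atoms_ne_zero (mem_ST.2 ⟨u, hu, u.self_mem_ST⟩) ?_
  simpa using hd.mono_right (Tree.atoms_le_of_mem_ST h)

theorem IsMLL.cut_eq {p : Net} (hp : p.IsMLL) {c d : Tree × Tree} (hc : c ∈ p.cuts)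
    (hd : d ∈ p.cuts) {t : Tree} (htc : t = c.1 ∨ t = c.2) (htd : t = d.1 ∨ t = d.2) : c = d := by
  by_contra hne
  have hn := hp.1
  rw [atoms_eq_sum_cuts, Multiset.nodup_add] at hn
  have hdis := disjoint_of_nodup_sum _ hn.1 (Finset.mem_toList.2 hc) (Finset.mem_toList.2 hd) hne
  have hle {e : Tree × Tree} (h : t = e.1 ∨ t = e.2) : t.atoms ≤ e.1.atoms + e.2.atoms := by
    rcases h with rfl | rfl
    · exact Multiset.le_add_right _ _
    · exact Multiset.le_add_left _ _
  refine hp.atoms_ne_zero (t := t) ?_ (by simpa using hdis.mono (hle htc) (hle htd))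
  rcases htc with rfl | rfl
  · exact fst_mem_ST hc
  · exact snd_mem_ST hc

theorem IsMLL.nodup_of_tens {p : Net} (hp : p.IsMLL) {ts : List Tree}
    (h : Tree.tens ts ∈ p.ST) : ts.Nodup := by
  obtain ⟨r, hr, ht⟩ := mem_ST.1 h
  have hn := hp.1
  rw [atoms_eq_sum_roots] at hn
  have hle : (Tree.tens ts).atoms ≤ (p.roots.map Tree.atoms).sum :=
    (Tree.atoms_le_of_mem_ST ht).trans (List.single_le_sum (by simp) _ (List.mem_map_of_mem hr))
  rw [Tree.atoms_tens] at hle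
  exact nodup_of_nodup_sum _ (Multiset.nodup_of_le hle hn)
    fun t ht => hp.atoms_ne_zero (premise_mem_ST_of_tens h ht)

/-! ### Switching paths -/

/-- The endpoints of an edge. -/
def ends (p : Net) (I : Tree → Tree) : Edge → Tree × Tree
  | .ax n => (.var n true, .var n false)
  | .tensE t u => (t, u)
  | .parrE t => (t, I t)
  | .jumpE m => (.counit m, p.jump m)
  | .cutE t u => (t, u)

theorem Adj.ends_eq {p : Net} {I : Tree → Tree} {e : Edge} {t u : Tree} (h : p.Adj I e t u) :
    p.ends I e = (t, u) ∨ p.ends I e = (u, t) := by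
  induction h with
  | symm _ ih => exact ih.symm
  | _ => exact Or.inl rfl

theorem Adj.congr {p : Net} {I I' : Tree → Tree} {e : Edge} {t u : Tree} (h : p.Adj I e t u)
    (hI : ∀ v, e = Edge.parrE v → I v = I' v) : p.Adj I' e t u := by
  induction h with
  | ax n h₁ h₂ => exact .ax n h₁ h₂
  | tens h₁ h₂ => exact .tens h₁ h₂
  | parr h => rw [hI _ rfl]; exact .parr h
  | jump h => exact .jump h
  | cut h => exact .cut h
  | symm _ ih => exact .symm (ih hI)

theorem IsTrail.of_append {p : Net} {I : Tree → Tree} {t : Tree} {l l' : List (Edge × Tree)}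
    (h : p.IsTrail I t (l ++ l')) :
    ∃ u, ReflTransGen (fun x y => ∃ e, p.Adj I e x y ∧ e ∈ l.map Prod.fst) t u ∧
      p.IsTrail I u l' := by
  induction l generalizing t with
  | nil => exact ⟨t, .refl, h⟩
  | cons a l ih =>
    cases h with
    | @cons _ e u _ hadj hl hne =>
      obtain ⟨v, hv, htr⟩ := ih hl
      refine ⟨v, .head ⟨e, hadj, List.mem_cons_self⟩ (ReflTransGen.mono ?_ _ _ hv), htr⟩
      rintro x y ⟨e', he', hmem⟩
      exact ⟨e', he', List.mem_cons_of_mem _ hmem⟩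

theorem IsTrail.of_cons {p : Net} {I : Tree → Tree} {t v : Tree} {e : Edge}
    {l : List (Edge × Tree)} (h : p.IsTrail I t ((e, v) :: l)) :
    p.Adj I e t v ∧ p.IsTrail I v l ∧ ∀ x ∈ l, x.1 ≠ e := by
  cases h with
  | cons h₁ h₂ h₃ => exact ⟨h₁, h₂, h₃⟩

/-- A walk avoiding the edges of a path can be shortened into a path extending it. -/
theorem IsTrail.exists_append {p : Net} {I : Tree → Tree} {A : Edge → Prop} {y : Tree}
    {l : List (Edge × Tree)} (hl : p.IsTrail I y l) (hA : ∀ x ∈ l, A x.1) {x : Tree}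
    (h : ReflTransGen (fun x y => ∃ e, p.Adj I e x y ∧ ¬ A e) x y) :
    ∃ l', p.IsTrail I x (l' ++ l) := by
  induction h using ReflTransGen.head_induction_on with
  | refl => exact ⟨[], hl⟩
  | @head a b hab _ ih =>
    obtain ⟨l', hl'⟩ := ih
    obtain ⟨e, hadj, he⟩ := hab
    by_cases hmem : ∃ v, (e, v) ∈ l'
    · obtain ⟨v, hv⟩ := hmem
      obtain ⟨l₁, l₂, rfl⟩ := List.append_of_mem hv
      rw [List.append_assoc, List.cons_append] at hl'
      obtain ⟨u, -, hu⟩ := hl'.of_append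
      obtain ⟨hadj', htr, hne⟩ := hu.of_cons
      have hv : v = a ∨ v = b := by
        rcases hadj.ends_eq with h₁ | h₁ <;> rcases hadj'.ends_eq with h₂ | h₂ <;>
          simp only [h₁, Prod.mk.injEq] at h₂ <;> simp [h₂]
      rcases hv with rfl | rfl
      · exact ⟨l₂, htr⟩
      · exact ⟨(e, v) :: l₂, .cons hadj htr hne⟩
    · refine ⟨(e, b) :: l', .cons hadj hl' ?_⟩
      rintro ⟨e', v⟩ hx rfl
      rcases List.mem_append.1 hx with hx | hx
      · exact hmem ⟨v, hx⟩
      · exact he (hA _ hx)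

end Net

/-! ### Connectedness -/

theorem eq_of_eqvGen {α β : Type*} {r : α → α → Prop} {f : α → β}
    (hf : ∀ x y, r x y → f x = f y) {x y : α} (h : EqvGen r x y) : f x = f y := by
  induction h with
  | rel x y h => exact hf x y h
  | refl => rfl
  | symm _ _ _ ih => exact ih.symm
  | trans _ _ _ _ _ ih₁ ih₂ => exact ih₁.trans ih₂

theorem eqvGen_of_le {α : Type*} {r r' : α → α → Prop} (hr : ∀ x y, r x y → EqvGen r' x y)
    {x y : α} (h : EqvGen r x y) : EqvGen r' x y := by
  induction h with
  | rel x y h => exact hr x y h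
  | refl => exact .refl _
  | symm _ _ _ ih => exact ih.symm
  | trans _ _ _ _ _ ih₁ ih₂ => exact ih₁.trans _ _ _ ih₂

theorem reflTransGen_of_eqvGen {α : Type*} {r : α → α → Prop} (hr : ∀ x y, r x y → r y x) {x y : α}
    (h : EqvGen r x y) : ReflTransGen r x y := by
  have : Std.Symm r := ⟨hr⟩
  rwa [EqvGen.eqvGen_eq_reflTransGen] at h

/-- Edges between the trees `T`, `P` and premises `ts` of an eliminated ⊗/⅋ cut, with `s` the
    premise selected at `P`. -/
inductive StarRel {α : Type*} (T P : α) (ts : List α) (s : α) : α → α → Prop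
  | tens {t} : t ∈ ts → StarRel T P ts s T t
  | cut : StarRel T P ts s T P
  | parr : StarRel T P ts s P s

/-- Edges after elimination: the trees `T` and `P` are kept as aliases of the first premises, so
    that jumps need no redirection. -/
inductive NewRel {α : Type*} (T P : α) (t₀ s₀ : α) (L : List (α × α)) : α → α → Prop
  | tens : NewRel T P t₀ s₀ L T t₀
  | parr : NewRel T P t₀ s₀ L P s₀
  | res {t s} : (t, s) ∈ L → NewRel T P t₀ s₀ L t s

/-- Pairs of vertices around an eliminated cut that its edges connect, for some switching. -/
inductive Linked {α : Type*} (T P : α) (ts ss : List α) : α → α → Prop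
  | tens_parr : Linked T P ts ss T P
  | tens_left {t} : t ∈ ts → Linked T P ts ss T t
  | parr_left {t} : t ∈ ts → Linked T P ts ss P t
  | left_left {t t'} : t ∈ ts → t' ∈ ts → t ≠ t' → Linked T P ts ss t t'
  | tens_right {s} : s ∈ ss → Linked T P ts ss T s
  | parr_right {s} : s ∈ ss → Linked T P ts ss P s
  | left_right {t s} : t ∈ ts → s ∈ ss → Linked T P ts ss t s

/-- If the relation `A` sends distinct components to components outside its domain, then adding `A`
    only identifies vertices whose components are equal or are sent to the same component. -/
theorem eqvGen_or_of_functional {α : Type*} {r A : α → α → Prop}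
    (hA : ∀ v z v' z', A v z → A v' z' → EqvGen r v v' → z = z')
    (hA' : ∀ v z v' z', A v z → A v' z' → ¬ EqvGen r z v')
    {x y : α} (h : EqvGen (fun x y => r x y ∨ A x y) x y) :
    ∃ w, ((∃ v z, A v z ∧ EqvGen r x v ∧ EqvGen r z w) ∨
        ((∀ v z, A v z → ¬ EqvGen r x v) ∧ EqvGen r x w)) ∧
      ((∃ v z, A v z ∧ EqvGen r y v ∧ EqvGen r z w) ∨
        ((∀ v z, A v z → ¬ EqvGen r y v) ∧ EqvGen r y w)) := by
  let N : α → α → Prop := fun x w => (∃ v z, A v z ∧ EqvGen r x v ∧ EqvGen r z w) ∨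
    ((∀ v z, A v z → ¬ EqvGen r x v) ∧ EqvGen r x w)
  have hN : ∀ x, ∃ w, N x w := fun x => by
    by_cases hx : ∃ v z, A v z ∧ EqvGen r x v
    · obtain ⟨v, z, hvz, hxv⟩ := hx
      exact ⟨z, Or.inl ⟨v, z, hvz, hxv, .refl _⟩⟩
    · push Not at hx
      exact ⟨x, Or.inr ⟨hx, .refl _⟩⟩
  have hmono : ∀ x y w, EqvGen r x y → N x w → N y w := by
    rintro x y w hxy (⟨v, z, hvz, hxv, hzw⟩ | ⟨hx, hxw⟩)
    · exact Or.inl ⟨v, z, hvz, (hxy.symm).trans _ _ _ hxv, hzw⟩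
    · exact Or.inr ⟨fun v z hvz hyv => hx v z hvz (hxy.trans _ _ _ hyv),
        (hxy.symm).trans _ _ _ hxw⟩
  have hNA : ∀ x y w, A x y → (N x w ↔ N y w) := by
    intro x y w hxy
    have hy : ∀ v z, A v z → ¬ EqvGen r y v := fun v z hvz => hA' x y v z hxy hvz
    constructor
    · rintro (⟨v, z, hvz, hxv, hzw⟩ | ⟨hx, -⟩)
      · rw [← hA x y v z hxy hvz hxv] at hzw
        exact Or.inr ⟨hy, hzw⟩
      · exact absurd (.refl _) (hx x y hxy)
    · rintro (⟨v, z, hvz, hyv, -⟩ | ⟨-, hyw⟩)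
      · exact absurd hyv (hy v z hvz)
      · exact Or.inl ⟨x, y, hxy, .refl _, hyw⟩
  have hxy : N x = N y := by
    refine eq_of_eqvGen (fun a b hab => funext fun w => propext ?_) h
    rcases hab with hab | hab
    · exact ⟨hmono a b w (.rel _ _ hab), hmono b a w (.symm _ _ (.rel _ _ hab))⟩
    · exact hNA a b w hab
  obtain ⟨w, hw⟩ := hN x
  exact ⟨w, hw, by rw [hxy] at hw; exact hw⟩

section

variable {α : Type*} {r : α → α → Prop} {T P t₀ s₀ : α} {ts ss : List α}

/-- Vertices identified after the elimination of a cut were already connected before it, for some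
    choice of the premise selected at `P`. -/
theorem exists_eqvGen_star (hts : ts.Nodup) (h₀ : (t₀, s₀) ∈ ts.zip ss)
    (hsep : ∀ x y, Linked T P ts ss x y → ¬ EqvGen r x y) {x y : α}
    (h : EqvGen (fun x y => r x y ∨ NewRel T P t₀ s₀ (ts.zip ss) x y) x y) :
    ∃ s ∈ ss, EqvGen (fun x y => r x y ∨ StarRel T P ts s x y) x y := by
  have hs₀ : s₀ ∈ ss := (List.of_mem_zip h₀).2
  let A : α → α → Prop := fun v z =>
    (v = T ∧ z = s₀) ∨ (v = P ∧ z = s₀) ∨ (v, z) ∈ ts.zip ss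
  have hsep' : ∀ x y, Linked T P ts ss x y → ¬ EqvGen r y x :=
    fun x y hxy hyx => hsep x y hxy hyx.symm
  have hA : ∀ v z v' z', A v z → A v' z' → EqvGen r v v' → z = z' := by
    rintro v z v' z' (⟨rfl, rfl⟩ | ⟨rfl, rfl⟩ | hvz) (⟨rfl, rfl⟩ | ⟨rfl, rfl⟩ | hvz') hvv'
    · rfl
    · rfl
    · exact absurd hvv' (hsep _ _ (.tens_left (List.of_mem_zip hvz').1))
    · rfl
    · rfl
    · exact absurd hvv' (hsep _ _ (.parr_left (List.of_mem_zip hvz').1))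
    · exact absurd hvv' (hsep' _ _ (.tens_left (List.of_mem_zip hvz).1))
    · exact absurd hvv' (hsep' _ _ (.parr_left (List.of_mem_zip hvz).1))
    · by_cases hv : v = v'
      · subst hv
        exact eq_of_mem_zip_of_nodup hts hvz hvz'
      · exact absurd hvv'
          (hsep _ _ (.left_left (List.of_mem_zip hvz).1 (List.of_mem_zip hvz').1 hv))
  have hAss : ∀ v z, A v z → z ∈ ss := by
    rintro v z (⟨-, rfl⟩ | ⟨-, rfl⟩ | hvz)
    exacts [hs₀, hs₀, (List.of_mem_zip hvz).2]
  have hA' : ∀ v z v' z', A v z → A v' z' → ¬ EqvGen r z v' := by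
    rintro v z v' z' hvz (⟨rfl, rfl⟩ | ⟨rfl, rfl⟩ | hvz')
    · exact hsep' _ _ (.tens_right (hAss _ _ hvz))
    · exact hsep' _ _ (.parr_right (hAss _ _ hvz))
    · exact hsep' _ _ (.left_right (List.of_mem_zip hvz').1 (hAss _ _ hvz))
  have hconn : ∀ s v z, A v z → EqvGen (fun x y => r x y ∨ StarRel T P ts s x y) T v := by
    rintro s v z (⟨rfl, -⟩ | ⟨rfl, -⟩ | hvz)
    · exact .refl _
    · exact .rel _ _ (Or.inr .cut)
    · exact .rel _ _ (Or.inr (.tens (List.of_mem_zip hvz).1))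
  have hr : ∀ s x y, EqvGen r x y → EqvGen (fun x y => r x y ∨ StarRel T P ts s x y) x y :=
    fun s x y => eqvGen_of_le fun a b hab => .rel _ _ (Or.inl hab)
  have hend : ∀ v z x y, A v z → EqvGen r x v → EqvGen r z y →
      EqvGen (fun x y => r x y ∨ StarRel T P ts z x y) x y := fun v z x y hvz hxv hzy =>
    (hr z _ _ hxv).trans _ _ _ <| ((hconn z v z hvz).symm).trans _ _ _ <|
      EqvGen.trans _ P _ (.rel _ _ (Or.inr .cut)) <|
      EqvGen.trans _ z _ (.rel _ _ (Or.inr .parr)) (hr z _ _ hzy)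
  have hA₀ : EqvGen (fun x y => r x y ∨ A x y) x y := by
    refine eqvGen_of_le ?_ h
    rintro a b (hab | hab)
    · exact .rel _ _ (Or.inl hab)
    · cases hab with
      | tens =>
        exact EqvGen.trans _ s₀ _ (.rel _ _ (Or.inr (Or.inl ⟨rfl, rfl⟩)))
          (.symm _ _ (.rel _ _ (Or.inr (Or.inr (Or.inr h₀)))))
      | parr => exact .rel _ _ (Or.inr (Or.inr (Or.inl ⟨rfl, rfl⟩)))
      | res hts => exact .rel _ _ (Or.inr (Or.inr (Or.inr hts)))
  obtain ⟨w, ⟨v, z, hvz, hxv, hzw⟩ | ⟨-, hxw⟩, ⟨v', z', hvz', hyv', hzw'⟩ | ⟨-, hyw⟩⟩ :=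
    eqvGen_or_of_functional hA hA' hA₀
  · exact ⟨z, hAss v z hvz, (hr z _ _ hxv).trans _ _ _ <|
      ((hconn z v z hvz).symm).trans _ _ _ <| (hconn z v' z' hvz').trans _ _ _ <|
      (hr z _ _ hyv').symm⟩
  · exact ⟨z, hAss v z hvz, hend v z x y hvz hxv (hzw.trans _ _ _ hyw.symm)⟩
  · exact ⟨z', hAss v' z' hvz', (hend v' z' y x hvz' hyv' (hzw'.trans _ _ _ hxw.symm)).symm⟩
  · exact ⟨s₀, hs₀, hr s₀ _ _ (hxw.trans _ _ _ hyw.symm)⟩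

/-- Contracting `T` with `t₀` and `P` with `s₀` does not connect other vertices. -/
theorem eqvGen_of_eqvGen_alias (ht₀ : t₀ ∈ ts) (hs₀ : s₀ ∈ ss)
    (hsep : ∀ x y, Linked T P ts ss x y → ¬ EqvGen r x y) {x y : α}
    (hx : ¬ EqvGen r x T ∧ ¬ EqvGen r x P) (hy : ¬ EqvGen r y T ∧ ¬ EqvGen r y P)
    (h : EqvGen (fun x y => r x y ∨ NewRel T P t₀ s₀ [] x y) x y) : EqvGen r x y := by
  have hsep' : ∀ x y, Linked T P ts ss x y → ¬ EqvGen r y x :=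
    fun x y hxy hyx => hsep x y hxy hyx.symm
  have key := eqvGen_or_of_functional (A := NewRel T P t₀ s₀ []) ?_ ?_ h
  · have hout : ∀ a, ¬ EqvGen r a T ∧ ¬ EqvGen r a P →
        ∀ v z, NewRel T P t₀ s₀ [] v z → ¬ EqvGen r a v := by
      rintro a ⟨h₁, h₂⟩ v z (_ | _ | hvz)
      exacts [h₁, h₂, absurd hvz List.not_mem_nil]
    obtain ⟨w, ⟨v, z, hvz, hxv, -⟩ | ⟨-, hxw⟩, ⟨v', z', hvz', hyv', -⟩ | ⟨-, hyw⟩⟩ := key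
    · exact absurd hxv (hout x hx v z hvz)
    · exact absurd hxv (hout x hx v z hvz)
    · exact absurd hyv' (hout y hy v' z' hvz')
    · exact hxw.trans _ _ _ hyw.symm
  · rintro v z v' z' (_ | _ | hvz) (_ | _ | hvz') hvv'
    · rfl
    · exact absurd hvv' (hsep _ _ .tens_parr)
    · exact absurd hvz' List.not_mem_nil
    · exact absurd hvv' (hsep' _ _ .tens_parr)
    · rfl
    · exact absurd hvz' List.not_mem_nil
    all_goals exact absurd hvz List.not_mem_nil
  · rintro v z v' z' (_ | _ | hvz) (_ | _ | hvz')
    · exact hsep' _ _ (.tens_left ht₀)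
    · exact hsep' _ _ (.parr_left ht₀)
    · exact absurd hvz' List.not_mem_nil
    · exact hsep' _ _ (.tens_right hs₀)
    · exact hsep' _ _ (.parr_right hs₀)
    · exact absurd hvz' List.not_mem_nil
    all_goals exact absurd hvz List.not_mem_nil

end

/-! ### Eliminated cuts -/

/-- The edges incident to the trees of an eliminated cut, except jumps to them. -/
def IsStarEdge (c : List Tree × List Tree) (e : Edge) : Prop :=
  (∃ t, e = Edge.tensE (Tree.tens c.1) t) ∨ e = Edge.parrE (Tree.parr c.2) ∨
    e = Edge.cutE (Tree.tens c.1) (Tree.parr c.2) ∨ e = Edge.cutE (Tree.parr c.2) (Tree.tens c.1)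

/-- Edges obtained by eliminating the cuts of `G` and deleting the star edges of the cuts
    satisfying `X`. -/
def ElimRel (p : Net) (I : Tree → Tree) (G : Finset (List Tree × List Tree))
    (X : List Tree × List Tree → Prop) (x y : Tree) : Prop :=
  (∃ e, p.Adj I e x y ∧ ∀ c, X c → ¬ IsStarEdge c e) ∨
    ∃ c ∈ G, NewRel (Tree.tens c.1) (Tree.parr c.2) c.1.headI c.2.headI (c.1.zip c.2) x y

/-- `Linked` for the trees of a cut. -/
abbrev CutLinked (c : List Tree × List Tree) (x y : Tree) : Prop :=
  Linked (Tree.tens c.1) (Tree.parr c.2) c.1 c.2 x y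

theorem headI_mem_zip {α β : Type*} [Inhabited α] [Inhabited β] {l : List α} {m : List β}
    (h : l.length = m.length) (h₀ : l ≠ []) : (l.headI, m.headI) ∈ l.zip m := by
  cases l with
  | nil => exact absurd rfl h₀
  | cons a l =>
    cases m with
    | nil => simp at h
    | cons b m => simp

theorem Net.IsSwitching.update {p : Net} {I : Tree → Tree} (hI : p.IsSwitching I)
    {ss : List Tree} {s : Tree} (hs : s ∈ ss) :
    p.IsSwitching (Function.update I (Tree.parr ss) s) := by
  intro ts hts
  by_cases h : Tree.parr ts = Tree.parr ss
  · rw [h, Function.update_self]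
    cases h
    exact hs
  · rw [Function.update_of_ne h]
    exact hI ts hts

section

variable {p : Net} {F : Finset (List Tree × List Tree)}

/-- The members of `F` are multiplicative cuts of `p`. -/
def IsMultFamily (p : Net) (F : Finset (List Tree × List Tree)) : Prop :=
  ∀ c ∈ F, c.1.length = c.2.length ∧ c.1 ≠ [] ∧
    ((Tree.tens c.1, Tree.parr c.2) ∈ p.cuts ∨ (Tree.parr c.2, Tree.tens c.1) ∈ p.cuts)

theorem IsMultFamily.tens_mem (hF : IsMultFamily p F) {c : List Tree × List Tree} (hc : c ∈ F) :
    Tree.tens c.1 ∈ p.ST := by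
  rcases (hF c hc).2.2 with h | h
  · exact Net.fst_mem_ST h
  · exact Net.snd_mem_ST h

theorem IsMultFamily.parr_mem (hF : IsMultFamily p F) {c : List Tree × List Tree} (hc : c ∈ F) :
    Tree.parr c.2 ∈ p.ST := by
  rcases (hF c hc).2.2 with h | h
  · exact Net.snd_mem_ST h
  · exact Net.fst_mem_ST h

theorem IsMultFamily.eq_of_isStarEdge (hp : p.IsMLL) (hF : IsMultFamily p F)
    {c c' : List Tree × List Tree} (hc : c ∈ F) (hc' : c' ∈ F) {e : Edge}
    (h : IsStarEdge c e) (h' : IsStarEdge c' e) : c = c' := by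
  have hcut : ∀ t, (t = Tree.tens c.1 ∨ t = Tree.parr c.2) →
      (t = Tree.tens c'.1 ∨ t = Tree.parr c'.2) → c = c' := by
    intro t ht ht'
    obtain ⟨c₁, c₂⟩ := c
    obtain ⟨c₁', c₂'⟩ := c'
    rcases (hF _ hc).2.2 with h | h <;> rcases (hF _ hc').2.2 with h' | h'
    · have := hp.cut_eq h h' ht ht'
      simp_all
    · have := hp.cut_eq h h' ht ht'.symm
      simp_all
    · have := hp.cut_eq h h' ht.symm ht'
      simp_all
    · have := hp.cut_eq h h' ht.symm ht'.symm
      simp_all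
  rcases h with ⟨t, rfl⟩ | rfl | rfl | rfl <;>
    rcases h' with ⟨t', h'⟩ | h' | h' | h' <;> cases c <;>
    cases c' <;> simp at h' <;> simp_all

/-- The edges around a cut connect linked trees by a nonempty path. -/
theorem IsMultFamily.exists_star_trail (hF : IsMultFamily p F) {c : List Tree × List Tree}
    (hc : c ∈ F) {I : Tree → Tree} (hI : p.IsSwitching I) {x y : Tree} (hxy : CutLinked c x y) :
    ∃ I' l, p.IsSwitching I' ∧ (∀ v, v ≠ Tree.parr c.2 → I' v = I v) ∧ p.IsTrail I' y l ∧
      (∀ a ∈ l, IsStarEdge c a.1) ∧ x ∈ l.map Prod.snd := by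
  have hT := hF.tens_mem hc
  have hP := hF.parr_mem hc
  obtain ⟨d, hd, hdadj⟩ : ∃ d, (d = Edge.cutE (Tree.tens c.1) (Tree.parr c.2) ∨
      d = Edge.cutE (Tree.parr c.2) (Tree.tens c.1)) ∧
      ∀ I, p.Adj I d (Tree.tens c.1) (Tree.parr c.2) := by
    rcases (hF c hc).2.2 with h | h
    · exact ⟨_, Or.inl rfl, fun I => .cut h⟩
    · exact ⟨_, Or.inr rfl, fun I => .symm (.cut h)⟩
  have hdstar : IsStarEdge c d := Or.inr (Or.inr hd)
  have hdT : ∀ t, d ≠ Edge.tensE (Tree.tens c.1) t := by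
    rintro t rfl; simp at hd
  have hdP : d ≠ Edge.parrE (Tree.parr c.2) := by
    rintro rfl; simp at hd
  have hTstar : ∀ t, IsStarEdge c (Edge.tensE (Tree.tens c.1) t) := fun t => Or.inl ⟨t, rfl⟩
  have hPstar : IsStarEdge c (Edge.parrE (Tree.parr c.2)) := Or.inr (Or.inl rfl)
  have hts : ∀ t ∈ c.1, t ∈ p.ST := fun t => Net.premise_mem_ST_of_tens hT
  have hpadj : ∀ s, p.Adj (Function.update I (Tree.parr c.2) s) (Edge.parrE (Tree.parr c.2))
      (Tree.parr c.2) s := fun s => by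
    have h := Net.Adj.parr (I := Function.update I (Tree.parr c.2) s) hP
    rwa [Function.update_self] at h
  have hupd : ∀ s v, v ≠ Tree.parr c.2 → Function.update I (Tree.parr c.2) s v = I v :=
    fun s v hv => Function.update_of_ne hv _ _
  cases hxy with
  | tens_parr =>
    exact ⟨I, [(d, Tree.tens c.1)], hI, fun _ _ => rfl,
      .cons (.symm (hdadj I)) (.nil _ hT) (by simp),
      by simp [hdstar], by simp⟩
  | tens_left ht =>
    exact ⟨I, [(_, Tree.tens c.1)], hI, fun _ _ => rfl,
      .cons (.symm (.tens hT ht)) (.nil _ hT) (by simp),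
      by simp [hTstar], by simp⟩
  | parr_left ht =>
    exact ⟨I, [(_, Tree.tens c.1), (d, Tree.parr c.2)], hI, fun _ _ => rfl,
      .cons (.symm (.tens hT ht)) (.cons (hdadj I) (.nil _ hP) (by simp)) (by simp [hdT]),
      by simp [hTstar, hdstar], by simp⟩
  | left_left ht ht' hne =>
    exact ⟨I, [(_, Tree.tens c.1), (_, x)], hI, fun _ _ => rfl,
      .cons (.symm (.tens hT ht')) (.cons (.tens hT ht) (.nil _ (hts _ ht)) (by simp))
        (by simp [hne]),
      by simp [hTstar], by simp⟩
  | tens_right hs =>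
    exact ⟨_, [(_, Tree.parr c.2), (d, Tree.tens c.1)], hI.update hs, hupd _,
      .cons (.symm (hpadj _)) (.cons (.symm (hdadj _)) (.nil _ hT) (by simp)) (by simp [hdP]),
      by simp [hPstar, hdstar], by simp⟩
  | parr_right hs =>
    exact ⟨_, [(_, Tree.parr c.2)], hI.update hs, hupd _,
      .cons (.symm (hpadj _)) (.nil _ hP) (by simp), by simp [hPstar], by simp⟩
  | left_right ht hs =>
    exact ⟨_, [(_, Tree.parr c.2), (d, Tree.tens c.1), (_, x)], hI.update hs, hupd _,
      .cons (.symm (hpadj _)) (.cons (.symm (hdadj _)) (.cons (.tens hT ht) (.nil _ (hts _ ht))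
        (by simp)) (by simp [(hdT _).symm])) (by simp [hdP]),
      by simp [hPstar, hdstar, hTstar], by simp⟩

/-- Linked trees are not connected without the edges around their cut, in an acyclic net. -/
theorem IsMultFamily.not_eqvGen_of_cutLinked (hF : IsMultFamily p F) (hpa : p.IsAcyclic)
    {c : List Tree × List Tree} (hc : c ∈ F) {I : Tree → Tree} (hI : p.IsSwitching I)
    {x y : Tree} (hxy : CutLinked c x y) :
    ¬ EqvGen (fun x y => ∃ e, p.Adj I e x y ∧ ¬ IsStarEdge c e) x y := by
  intro h
  obtain ⟨I', l, hI', hagree, htr, hstar, hx⟩ := hF.exists_star_trail hc hI hxy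
  have hwalk := reflTransGen_of_eqvGen (fun x y ⟨e, he, hne⟩ => ⟨e, he.symm, hne⟩) h
  have hwalk' : ReflTransGen (fun x y => ∃ e, p.Adj I' e x y ∧ ¬ IsStarEdge c e) x y := by
    refine ReflTransGen.mono ?_ _ _ hwalk
    rintro a b ⟨e, he, hne⟩
    refine ⟨e, he.congr fun v hv => (hagree v ?_).symm, hne⟩
    rintro rfl
    exact hne (Or.inr (Or.inl hv))
  obtain ⟨l', hl'⟩ := htr.exists_append hstar hwalk'
  have hnd := hpa I' hI' x _ hl'
  rw [List.nodup_cons, List.map_append] at hnd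
  exact hnd.1 (List.mem_append_right _ hx)

/-- Eliminating other cuts does not connect the trees linked by a cut. -/
theorem IsMultFamily.not_eqvGen_elimRel (hp : p.IsMLL) (hpa : p.IsAcyclic)
    (hF : IsMultFamily p F) {G : Finset (List Tree × List Tree)} (hG : G ⊆ F)
    {c : List Tree × List Tree} (hc : c ∈ F) (hcG : c ∉ G) {I : Tree → Tree}
    (hI : p.IsSwitching I) {x y : Tree} (hxy : CutLinked c x y) :
    ¬ EqvGen (ElimRel p I G fun c' => c' = c ∨ c' ∈ G) x y := by
  induction G using Finset.induction_on generalizing c I x y with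
  | empty =>
    intro h
    refine hF.not_eqvGen_of_cutLinked hpa hc hI hxy (eqvGen_of_le ?_ h)
    rintro a b (⟨e, he, hne⟩ | ⟨c', hc', -⟩)
    · exact .rel _ _ ⟨e, he, hne c (Or.inl rfl)⟩
    · exact absurd hc' (Finset.notMem_empty _)
  | insert d G hdG ih =>
    have hdF : d ∈ F := hG (Finset.mem_insert_self d G)
    have hG' : G ⊆ F := (Finset.subset_insert d G).trans hG
    have hcd : c ≠ d := fun h => hcG (h ▸ Finset.mem_insert_self d G)
    have hcG' : c ∉ G := fun h => hcG (Finset.mem_insert_of_mem h)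
    intro h
    let X : List Tree × List Tree → Prop := fun c' => c' = c ∨ c' ∈ insert d G
    obtain ⟨hlen, hne, -⟩ := hF d hdF
    have h' : EqvGen (fun x y => ElimRel p I G X x y ∨ NewRel (Tree.tens d.1) (Tree.parr d.2)
        d.1.headI d.2.headI (d.1.zip d.2) x y) x y := by
      refine eqvGen_of_le ?_ h
      rintro a b (hab | ⟨c', hc', hab⟩)
      · exact .rel _ _ (Or.inl (Or.inl hab))
      · rcases Finset.mem_insert.1 hc' with rfl | hc'
        · exact .rel _ _ (Or.inr hab)
        · exact .rel _ _ (Or.inl (Or.inr ⟨c', hc', hab⟩))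
    have hsep : ∀ x y, CutLinked d x y → ¬ EqvGen (ElimRel p I G X) x y := by
      intro x y hxy h
      refine ih hG' hdF hdG hI hxy (eqvGen_of_le ?_ h)
      rintro a b (⟨e, he, hX⟩ | hab)
      · refine .rel _ _ (Or.inl ⟨e, he, ?_⟩)
        rintro c' (rfl | hc')
        · exact hX _ (Or.inr (Finset.mem_insert_self _ _))
        · exact hX _ (Or.inr (Finset.mem_insert_of_mem hc'))
      · exact .rel _ _ (Or.inr hab)
    obtain ⟨s, hs, hstar⟩ := exists_eqvGen_star (hp.nodup_of_tens (hF.tens_mem hdF))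
      (headI_mem_zip hlen hne) hsep h'
    refine ih hG' hc hcG' (hI.update (ss := d.2) hs) hxy (eqvGen_of_le ?_ hstar)
    have hother : ∀ e, IsStarEdge d e → ∀ c', c' = c ∨ c' ∈ G → ¬ IsStarEdge c' e := by
      rintro e he c' (rfl | hc') he'
      · exact hcd (hF.eq_of_isStarEdge hp hc hdF he' he)
      · exact hdG (hF.eq_of_isStarEdge hp (hG' hc') hdF he' he ▸ hc')
    rintro a b ((⟨e, he, hX⟩ | hab) | hab)
    · refine .rel _ _ (Or.inl ⟨e, he.congr fun v hv => ?_, ?_⟩)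
      · refine (Function.update_of_ne ?_ _ _).symm
        rintro rfl
        exact hX d (Or.inr (Finset.mem_insert_self _ _)) (Or.inr (Or.inl hv))
      · rintro c' (rfl | hc')
        · exact hX _ (Or.inl rfl)
        · exact hX _ (Or.inr (Finset.mem_insert_of_mem hc'))
    · exact .rel _ _ (Or.inr hab)
    · cases hab with
      | tens ht =>
        exact .rel _ _ (Or.inl ⟨_, .tens (hF.tens_mem hdF) ht, hother _ (Or.inl ⟨_, rfl⟩)⟩)
      | cut =>
        rcases (hF d hdF).2.2 with h | h
        · exact .rel _ _ (Or.inl ⟨_, .cut h, hother _ (Or.inr (Or.inr (Or.inl rfl)))⟩)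
        · exact .rel _ _ (Or.inl ⟨_, .symm (.cut h), hother _ (Or.inr (Or.inr (Or.inr rfl)))⟩)
      | parr =>
        have hadj := Net.Adj.parr (I := Function.update I (Tree.parr d.2) s) (hF.parr_mem hdF)
        rw [Function.update_self] at hadj
        exact .rel _ _ (Or.inl ⟨_, hadj, hother _ (Or.inr (Or.inl rfl))⟩)

end

/-! ### Parallel multiplicative reduction -/

namespace ParStepF

variable {p q : Net} {F : Finset (List Tree × List Tree)}

theorem mem_cuts (h : ParStepF p q F [] []) {d : Tree × Tree} :
    d ∈ q.cuts ↔ (d ∈ p.cuts ∧ ∀ c ∈ F, d ≠ (Tree.tens c.1, Tree.parr c.2) ∧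
      d ≠ (Tree.parr c.2, Tree.tens c.1)) ∨ ∃ c ∈ F, d ∈ c.1.zip c.2 := by
  rw [h.hcuts]
  simp [Tree.substList, melim, mres, aelim, eelim]

theorem concl_eq (h : ParStepF p q F [] []) : q.concl = p.concl := by
  rw [h.hconcl]
  exact List.map_id _

theorem ST_subset (h : ParStepF p q F [] []) : q.ST ⊆ p.ST := by
  have hF : IsMultFamily p F := h.hF
  have hroot : ∀ r ∈ q.roots, r ∈ p.ST := by
    intro r hr
    rcases Net.mem_roots.1 hr with ⟨d, hd, hrd⟩ | hr
    · rcases h.mem_cuts.1 hd with ⟨hd, -⟩ | ⟨c, hc, hd⟩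
      · rcases hrd with rfl | rfl
        · exact Net.fst_mem_ST hd
        · exact Net.snd_mem_ST hd
      · obtain ⟨h₁, h₂⟩ := List.of_mem_zip (show (d.1, d.2) ∈ c.1.zip c.2 from hd)
        rcases hrd with rfl | rfl
        · exact Net.premise_mem_ST_of_tens (hF.tens_mem hc) h₁
        · exact Net.premise_mem_ST_of_parr (hF.parr_mem hc) h₂
    · rw [h.concl_eq] at hr
      exact Net.mem_ST.2 ⟨r, Net.mem_roots.2 (Or.inr hr), r.self_mem_ST⟩
  intro t ht
  obtain ⟨r, hr, ht⟩ := Net.mem_ST.1 ht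
  exact Net.ST_subset (hroot r hr) ht

theorem headI_mem_cuts (h : ParStepF p q F [] []) {c : List Tree × List Tree} (hc : c ∈ F) :
    (c.1.headI, c.2.headI) ∈ q.cuts :=
  h.mem_cuts.2 (Or.inr ⟨c, hc, headI_mem_zip (h.hF c hc).1 (h.hF c hc).2.1⟩)

theorem tens_notMem_ST (hq : q.IsMLL) (h : ParStepF p q F [] []) {c : List Tree × List Tree}
    (hc : c ∈ F) : Tree.tens c.1 ∉ q.ST := by
  intro hmem
  obtain ⟨r, hr, hT⟩ := Net.mem_ST.1 hmem
  have hhead := (List.of_mem_zip (headI_mem_zip (h.hF c hc).1 (h.hF c hc).2.1)).1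
  have hsub : c.1.headI ∈ r.ST :=
    Tree.ST_subset hT (Tree.mem_ST_tens.2 (Or.inr ⟨_, hhead, Tree.self_mem_ST _⟩))
  have heq : c.1.headI = r := hq.eq_of_root_mem_ST
    (Net.mem_roots.2 (Or.inl ⟨_, h.headI_mem_cuts hc, Or.inl rfl⟩)) hr hsub
  have hle := Tree.sizeOf_le_of_mem_ST hT
  have hlt := List.sizeOf_lt_of_mem hhead
  rw [heq] at hlt
  simp only [Tree.tens.sizeOf_spec] at hle
  omega

theorem parr_notMem_ST (hq : q.IsMLL) (h : ParStepF p q F [] []) {c : List Tree × List Tree}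
    (hc : c ∈ F) : Tree.parr c.2 ∉ q.ST := by
  intro hmem
  obtain ⟨r, hr, hT⟩ := Net.mem_ST.1 hmem
  have hhead := (List.of_mem_zip (headI_mem_zip (h.hF c hc).1 (h.hF c hc).2.1)).2
  have hsub : c.2.headI ∈ r.ST :=
    Tree.ST_subset hT (Tree.mem_ST_parr.2 (Or.inr ⟨_, hhead, Tree.self_mem_ST _⟩))
  have heq : c.2.headI = r := hq.eq_of_root_mem_ST
    (Net.mem_roots.2 (Or.inl ⟨_, h.headI_mem_cuts hc, Or.inr rfl⟩)) hr hsub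
  have hle := Tree.sizeOf_le_of_mem_ST hT
  have hlt := List.sizeOf_lt_of_mem hhead
  rw [heq] at hlt
  simp only [Tree.parr.sizeOf_spec] at hle
  omega

theorem jump_eq (h : ParStepF p q F [] []) {m : ℕ} (hm : Tree.counit m ∈ q.ST) :
    (∃ c ∈ F, p.jump m = Tree.tens c.1 ∧ q.jump m = c.1.headI) ∨
      (∃ c ∈ F, p.jump m = Tree.parr c.2 ∧ q.jump m = c.2.headI) ∨ q.jump m = p.jump m := by
  have := h.hjump m hm
  simp only [Tree.substList, List.foldl_nil, List.length_nil, Nat.not_lt_zero, false_and,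
    exists_false, false_or] at this
  rcases this with h | h | ⟨-, -, -, h⟩
  · exact Or.inl h
  · exact Or.inr (Or.inl h)
  · exact Or.inr (Or.inr h)

/-- An edge of the reduct other than the residuals of `c` connects its endpoints in the net where
    all cuts but `c` have been eliminated, the trees of `c` being aliases of their first
    premises. -/
theorem eqvGen_of_adj (hq : q.IsMLL) (h : ParStepF p q F [] []) {c : List Tree × List Tree}
    {J I : Tree → Tree} (hIJ : ∀ v ∈ q.ST, I v = J v) {e : Edge} {x y : Tree}
    (hadj : q.Adj J e x y) (he : e ∉ resEdges c) :
    EqvGen (fun x y => ElimRel p I (F.erase c) (· ∈ F) x y ∨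
      NewRel (Tree.tens c.1) (Tree.parr c.2) c.1.headI c.2.headI [] x y) x y := by
  have hsub := h.ST_subset
  have keep : ∀ {e x y}, p.Adj I e x y → (∀ c ∈ F, ¬ IsStarEdge c e) →
      EqvGen (fun x y => ElimRel p I (F.erase c) (· ∈ F) x y ∨
        NewRel (Tree.tens c.1) (Tree.parr c.2) c.1.headI c.2.headI [] x y) x y :=
    fun hadj hstar => .rel _ _ (Or.inl (Or.inl ⟨_, hadj, hstar⟩))
  have alias_edge : ∀ {c'}, c' ∈ F → ∀ x y,
      NewRel (Tree.tens c'.1) (Tree.parr c'.2) c'.1.headI c'.2.headI [] x y →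
      EqvGen (fun x y => ElimRel p I (F.erase c) (· ∈ F) x y ∨
        NewRel (Tree.tens c.1) (Tree.parr c.2) c.1.headI c.2.headI [] x y) x y := by
    intro c' hc' x y hxy
    by_cases hcc : c' = c
    · subst hcc
      exact .rel _ _ (Or.inr hxy)
    · refine .rel _ _ (Or.inl (Or.inr ⟨c', Finset.mem_erase.2 ⟨hcc, hc'⟩, ?_⟩))
      cases hxy with
      | tens => exact .tens
      | parr => exact .parr
      | res hmem => exact absurd hmem List.not_mem_nil
  induction hadj with
  | ax n h₁ h₂ =>
    exact keep (.ax n (hsub h₁) (hsub h₂)) fun c _ hs => by simp [IsStarEdge] at hs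
  | @tens ts t hts ht =>
    refine keep (.tens (hsub hts) ht) fun c hc hs => ?_
    simp only [IsStarEdge, Edge.tensE.injEq, exists_and_left, exists_eq', and_true, reduceCtorEq,
      or_false] at hs
    exact h.tens_notMem_ST hq hc (hs ▸ hts)
  | @parr ts hts =>
    rw [← hIJ _ hts]
    refine keep (.parr (hsub hts)) fun c hc hs => ?_
    simp only [IsStarEdge, Edge.parrE.injEq, exists_false, reduceCtorEq, or_false, false_or] at hs
    exact h.parr_notMem_ST hq hc (hs ▸ hts)
  | @jump m hm =>
    have hj : p.Adj I (Edge.jumpE m) (Tree.counit m) (p.jump m) := .jump (hsub hm)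
    have hj' := keep hj fun c _ hs => by simp [IsStarEdge] at hs
    rcases h.jump_eq hm with ⟨c', hc', h₁, h₂⟩ | ⟨c', hc', h₁, h₂⟩ | h₁
    · rw [h₂]
      rw [h₁] at hj'
      exact hj'.trans _ _ _ (alias_edge hc' _ _ .tens)
    · rw [h₂]
      rw [h₁] at hj'
      exact hj'.trans _ _ _ (alias_edge hc' _ _ .parr)
    · rw [h₁]
      exact hj'
  | @cut t s hts =>
    rcases h.mem_cuts.1 hts with ⟨hts, hne⟩ | ⟨c', hc', hts⟩
    · refine keep (.cut hts) fun c hc hs => ?_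
      obtain ⟨h₁, h₂⟩ := hne c hc
      simp only [IsStarEdge, reduceCtorEq, exists_false, Edge.cutE.injEq, false_or] at hs
      rcases hs with ⟨rfl, rfl⟩ | ⟨rfl, rfl⟩
      · exact h₁ rfl
      · exact h₂ rfl
    · have hcc : c' ≠ c := by
        rintro rfl
        exact he (List.mem_toFinset.2 (List.mem_map.2 ⟨(t, s), hts, rfl⟩))
      exact .rel _ _ (Or.inl (Or.inr ⟨c', Finset.mem_erase.2 ⟨hcc, hc'⟩, .res hts⟩))
  | symm _ ih => exact (ih he).symm

/-- Two premises of `c`, one of which is a ⊗-premise, are not connected in the reduct without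
    crossing residuals of `c`. -/
theorem not_eqvGen_premises (hp : p.IsMLL) (hq : q.IsMLL) (hpa : p.IsAcyclic)
    (h : ParStepF p q F [] []) {c : List Tree × List Tree} (hc : c ∈ F) {J : Tree → Tree}
    (hJ : q.IsSwitching J) {t u : Tree} (ht : t ∈ c.1) (hu : (u ∈ c.1 ∧ t ≠ u) ∨ u ∈ c.2) :
    ¬ EqvGen (fun x y => ∃ e, q.Adj J e x y ∧ e ∉ resEdges c) t u := by
  have hF : IsMultFamily p F := h.hF
  let I : Tree → Tree := fun v =>
    if v ∈ q.ST then J v else match v with | Tree.parr ts => ts.headI | _ => v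
  have hIJ : ∀ v ∈ q.ST, I v = J v := fun v hv => if_pos hv
  have hI : p.IsSwitching I := by
    intro ts hts
    by_cases hmem : Tree.parr ts ∈ q.ST
    · rw [hIJ _ hmem]
      exact hJ ts hmem
    · have hne := hp.2.2.1 ts hts
      simp only [I, if_neg hmem]
      cases ts with
      | nil => exact absurd rfl hne
      | cons a ts => simp
  have hsep : ∀ x y, CutLinked c x y → ¬ EqvGen (ElimRel p I (F.erase c) (· ∈ F)) x y := by
    intro x y hxy hconn
    refine hF.not_eqvGen_elimRel hp hpa (Finset.erase_subset c F) hc (Finset.notMem_erase c F) hI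
      hxy (eqvGen_of_le ?_ hconn)
    rintro a b (⟨e, he, hX⟩ | hab)
    · refine .rel _ _ (Or.inl ⟨e, he, fun c' hc' => hX c' ?_⟩)
      rcases hc' with rfl | hc'
      · exact hc
      · exact Finset.mem_of_mem_erase hc'
    · exact .rel _ _ (Or.inr hab)
  have hsep' : ∀ x y, CutLinked c x y → ¬ EqvGen (ElimRel p I (F.erase c) (· ∈ F)) y x :=
    fun x y hxy hyx => hsep x y hxy hyx.symm
  obtain ⟨ht₀, hs₀⟩ := List.of_mem_zip (headI_mem_zip (hF c hc).1 (hF c hc).2.1)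
  intro hconn
  have hconn' := eqvGen_of_le
    (fun a b ⟨e, hadj, he⟩ => h.eqvGen_of_adj hq hIJ hadj he) hconn
  have hu' : CutLinked c t u ∧ CutLinked c (Tree.tens c.1) u ∧ CutLinked c (Tree.parr c.2) u := by
    rcases hu with ⟨hu, hne⟩ | hu
    · exact ⟨.left_left ht hu hne, .tens_left hu, .parr_left hu⟩
    · exact ⟨.left_right ht hu, .tens_right hu, .parr_right hu⟩
  exact hsep _ _ hu'.1 (eqvGen_of_eqvGen_alias ht₀ hs₀ hsep
    ⟨hsep' _ _ (.tens_left ht), hsep' _ _ (.parr_left ht)⟩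
    ⟨hsep' _ _ hu'.2.1, hsep' _ _ hu'.2.2⟩ hconn')

/-- Residuals of `c` crossed successively by a path are crossed towards the ⅋-premise, then towards
    the ⊗-premise. -/
theorem successive_residuals (hp : p.IsMLL) (hq : q.IsMLL) (hpa : p.IsAcyclic)
    (h : ParStepF p q F [] []) {c : List Tree × List Tree} (hc : c ∈ F) {J : Tree → Tree}
    (hJ : q.IsSwitching J) {t₀ : Tree} {l₁ l₂ l₃ : List (Edge × Tree)} {a b : Edge × Tree}
    (hl : q.IsTrail J t₀ (l₁ ++ a :: (l₂ ++ b :: l₃))) (ha : a.1 ∈ resEdges c)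
    (hb : b.1 ∈ resEdges c) (hl₂ : ∀ x ∈ l₂, x.1 ∉ resEdges c) :
    ∃ t s t' s', (t, s) ∈ c.1.zip c.2 ∧ (t', s') ∈ c.1.zip c.2 ∧
      a = (Edge.cutE t s, s) ∧ b = (Edge.cutE t' s', t') := by
  obtain ⟨d, v⟩ := a
  obtain ⟨d', v'⟩ := b
  obtain ⟨u, -, htr⟩ := hl.of_append
  obtain ⟨hadj, htr, hne⟩ := htr.of_cons
  obtain ⟨u', hwalk, htr⟩ := htr.of_append
  obtain ⟨hadj', -, -⟩ := htr.of_cons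
  have hdd' : d' ≠ d := hne (d', v') (by simp)
  have hconn : EqvGen (fun x y => ∃ e, q.Adj J e x y ∧ e ∉ resEdges c) v u' := by
    refine EqvGen.reflTransGen_le_eqvGen _ _ _ (ReflTransGen.mono ?_ _ _ hwalk)
    rintro x y ⟨e, he, hmem⟩
    obtain ⟨z, hz, rfl⟩ := List.mem_map.1 hmem
    exact ⟨z.1, he, hl₂ z hz⟩
  have hsep := fun {t u} => h.not_eqvGen_premises hp hq hpa hc hJ (t := t) (u := u)
  obtain ⟨⟨t, s⟩, hts, rfl⟩ := List.mem_map.1 (List.mem_toFinset.1 ha)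
  obtain ⟨⟨t', s'⟩, hts', rfl⟩ := List.mem_map.1 (List.mem_toFinset.1 hb)
  obtain ⟨ht, hs⟩ := List.of_mem_zip hts
  obtain ⟨ht', hs'⟩ := List.of_mem_zip hts'
  have hv := hadj.ends_eq
  have hv' := hadj'.ends_eq
  simp only [Net.ends, Prod.mk.injEq] at hv hv'
  rcases hv with ⟨rfl, rfl⟩ | ⟨rfl, rfl⟩ <;> rcases hv' with ⟨rfl, rfl⟩ | ⟨rfl, rfl⟩
  · exact absurd hconn.symm (hsep ht' (Or.inr hs))
  · exact ⟨_, _, _, _, hts, hts', rfl, rfl⟩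
  · refine absurd hconn (hsep ht (Or.inl ⟨ht', ?_⟩))
    rintro rfl
    have hF : IsMultFamily p F := h.hF
    exact hdd' (by rw [eq_of_mem_zip_of_nodup (hp.nodup_of_tens (hF.tens_mem hc)) hts hts'])
  · exact absurd hconn (hsep ht (Or.inr hs'))

end ParStepF

/-- Let `p ⇒m q` be a parallel multiplicative reduction of
    acyclic MLL proof nets, `χ` a path in `q`, and `c` an eliminated cut of
    `p`. Then `χ` crosses at most two residual cut edges of `c`; if it
    crosses two, then `χ = χ₁(t ∼ s)χ₂(s' ∼ t')χ₃`, crossing the first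
    residual `⟨t|s⟩` from its ⊗-premise `t` to its ⅋-premise `s`, and later
    the other residual `⟨t'|s'⟩` from its ⅋-premise `s'` to its ⊗-premise
    `t'`. -/
theorem slipknot_structure (p q : Net) (F : Finset (List Tree × List Tree))
    (hp : p.IsMLL) (hq : q.IsMLL) (hpa : p.IsAcyclic) (hqa : q.IsAcyclic)
    (hstep : ParStepF p q F [] [])
    (c : List Tree × List Tree) (hc : c ∈ F)
    (J : Tree → Tree) (hJ : q.IsSwitching J)
    (t₀ : Tree) (l : List (Edge × Tree)) (hl : q.IsTrail J t₀ l) :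
    (l.filter fun x => decide (x.1 ∈ resEdges c)).length ≤ 2 ∧
    ((l.filter fun x => decide (x.1 ∈ resEdges c)).length = 2 →
      ∃ (l₁ l₂ l₃ : List (Edge × Tree)) (t s t' s' : Tree),
        (t, s) ∈ c.1.zip c.2 ∧ (t', s') ∈ c.1.zip c.2 ∧
        l = l₁ ++ (Edge.cutE t s, s) :: l₂ ++ (Edge.cutE t' s', t') :: l₃) := by
  have filter_cons : ∀ {a : Edge × Tree} {as l},
      l.filter (fun x => decide (x.1 ∈ resEdges c)) = a :: as → ∃ l₁ l₂, l = l₁ ++ a :: l₂ ∧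
        (∀ x ∈ l₁, x.1 ∉ resEdges c) ∧ a.1 ∈ resEdges c ∧
        l₂.filter (fun x => decide (x.1 ∈ resEdges c)) = as := by
    intro a as l h
    obtain ⟨l₁, l₂, h₁, h₂, h₃, h₄⟩ := List.filter_eq_cons_iff.1 h
    exact ⟨l₁, l₂, h₁, by simpa using h₂, by simpa using h₃, h₄⟩
  rcases hfil : l.filter fun x => decide (x.1 ∈ resEdges c) with _ | ⟨a, _ | ⟨b, _ | ⟨d, as⟩⟩⟩
  · simp [hfil]
  · simp [hfil]
  · rw [hfil]
    refine ⟨le_rfl, fun _ => ?_⟩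
    obtain ⟨l₁, m, rfl, -, ha, hm⟩ := filter_cons hfil
    obtain ⟨l₂, l₃, rfl, hl₂, hb, -⟩ := filter_cons hm
    obtain ⟨t, s, t', s', hts, hts', rfl, rfl⟩ :=
      hstep.successive_residuals hp hq hpa hc hJ hl ha hb hl₂
    exact ⟨l₁, l₂, l₃, t, s, t', s', hts, hts', by simp⟩
  · exfalso
    obtain ⟨l₁, m, rfl, -, ha, hm⟩ := filter_cons hfil
    obtain ⟨l₂, m', rfl, hl₂, hb, hm'⟩ := filter_cons hm
    obtain ⟨l₃, l₄, rfl, hl₃, hd, -⟩ := filter_cons hm'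
    obtain ⟨-, -, t, s, -, hts, -, rfl⟩ :=
      hstep.successive_residuals hp hq hpa hc hJ hl ha hb hl₂
    have hl' : q.IsTrail J t₀ ((l₁ ++ a :: l₂) ++ (Edge.cutE t s, t) :: (l₃ ++ d :: l₄)) := by
      simpa using hl
    obtain ⟨t', s', -, -, hts', -, h₁, -⟩ :=
      hstep.successive_residuals hp hq hpa hc hJ hl' hb hd hl₃
    simp only [Prod.mk.injEq] at h₁
    exact hstep.not_eqvGen_premises hp hq hpa hc hJ (List.of_mem_zip hts).1
      (Or.inr (h₁.2 ▸ (List.of_mem_zip hts').2)) (.refl _)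

end MLLNets
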